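/- arXiv:1210.2568 — 9 statements merged into one kernel-verified Lean document; each statement's English description precedes it below -/
import Mathlib

section
/- Let m ≥ 3 and let D_m be the dihedral group of order 2m. For all A, A', B, B' ∈ ℤ_m, the containers C(A,B) and C(A',B') have nonempty intersection if and only if A = A' in ℤ_m. -/
open DihedralGroup

/-- The commutator `[g,h] = g⁻¹ h⁻¹ g h`. -/
def gcomm {G : Type*} [Group G] (g h : G) : G := g⁻¹ * h⁻¹ * g * h

/-- The right commutation map `ρ(g) : x ↦ [x,g]`. -/
def rmap {G : Type*} [Group G] (g : G) : G → G := fun x => gcomm x g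

/-- The left commutation map `λ(g) : x ↦ [g,x]`. -/
def lmap {G : Type*} [Group G] (g : G) : G → G := fun x => gcomm g x

/-- The element `a^i b^j` of the dihedral group `D_m`, where `a = r 1`, `b = sr 0`. -/
def elt (m : ℕ) (i : ZMod m) (j : ZMod 2) : DihedralGroup m :=
  r i * (sr 0 : DihedralGroup m) ^ j.val

/-- The map `μ(A,B)`, sending `a^i b^j` to `a^(A·i·(-1)^j − B·((-1)^j − 1))`.
Note `sr k = a^(-k) b`, so `μ(A,B)` sends `sr k` to `r (A·k + 2·B)`. -/
def mumap (m : ℕ) (A B : ZMod m) : DihedralGroup m → DihedralGroup m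
  | .r i => .r (A * i)
  | .sr k => .r (A * k + 2 * B)

/-- The `(A,B)`-container `C(A,B) = { μ(A, x·B) : x ∈ ℤ_m }`. -/
def cont (m : ℕ) (A B : ZMod m) : Set (DihedralGroup m → DihedralGroup m) :=
  { f | ∃ x : ZMod m, f = mumap m A (x * B) }

/-- Lemma 6: `C(A,B) ∩ C(A',B') ≠ ∅` if and only if `A = A'` in `ℤ_m`. -/
theorem stmt_4 (m : ℕ) (hm : 3 ≤ m) (A A' B B' : ZMod m) :
    (cont m A B ∩ cont m A' B').Nonempty ↔ A = A' := by
  constructor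
  · rintro ⟨f, ⟨x, hx⟩, ⟨y, hy⟩⟩
    have h := congrFun (hx.symm.trans hy) (r 1)
    simpa [mumap] using h
  · rintro rfl
    exact ⟨mumap m A 0, ⟨0, by rw [zero_mul]⟩, ⟨0, by rw [zero_mul]⟩⟩
end

section
/- Let m ≥ 3 and let D_m be the dihedral group of order 2m. Then the set of all right commutation maps {ρ(g) : g ∈ D_m} equals the disjoint union C(0,1) ∪ C(−2,1), and the set of all left commutation maps {λ(g) : g ∈ D_m} equals the disjoint union C(0,1) ∪ C(2,1) (in both cases the two containers are disjoint). -/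
open DihedralGroup

theorem mumap_left_injective {m : ℕ} {A A' B B' : ZMod m}
    (h : mumap m A B = mumap m A' B') : A = A' := by
  simpa [mumap] using congrFun h (r 1)

theorem disjoint_cont {m : ℕ} {A A' : ZMod m} (h : A ≠ A') (B B' : ZMod m) :
    Disjoint (cont m A B) (cont m A' B') := by
  rw [Set.disjoint_left]
  rintro f ⟨x, rfl⟩ ⟨y, hy⟩
  exact h (mumap_left_injective hy)

theorem rmap_r {m : ℕ} (c : ZMod m) : rmap (r c) = mumap m 0 c := by
  funext x
  rcases x with i | k <;> simp [rmap, gcomm, mumap, two_mul]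

theorem rmap_sr {m : ℕ} (c : ZMod m) : rmap (sr c) = mumap m (-2) c := by
  funext x
  rcases x with i | k <;> simp [rmap, gcomm, mumap] <;> ring

theorem lmap_r {m : ℕ} (c : ZMod m) : lmap (r c) = mumap m 0 (-c) := by
  funext x
  rcases x with i | k <;> simp [lmap, gcomm, mumap]
  ring

theorem lmap_sr {m : ℕ} (c : ZMod m) : lmap (sr c) = mumap m 2 (-c) := by
  funext x
  rcases x with i | k <;> simp [lmap, gcomm, mumap] <;> ring

theorem setOf_rmap (m : ℕ) :
    {f | ∃ g : DihedralGroup m, f = rmap g} = cont m 0 1 ∪ cont m (-2) 1 := by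
  ext f
  constructor
  · rintro ⟨c | c, rfl⟩
    · exact Or.inl ⟨c, by rw [rmap_r, mul_one]⟩
    · exact Or.inr ⟨c, by rw [rmap_sr, mul_one]⟩
  · rintro (⟨c, rfl⟩ | ⟨c, rfl⟩)
    · exact ⟨r c, by rw [rmap_r, mul_one]⟩
    · exact ⟨sr c, by rw [rmap_sr, mul_one]⟩

theorem setOf_lmap (m : ℕ) :
    {f | ∃ g : DihedralGroup m, f = lmap g} = cont m 0 1 ∪ cont m 2 1 := by
  ext f
  constructor
  · rintro ⟨c | c, rfl⟩
    · exact Or.inl ⟨-c, by rw [lmap_r, mul_one]⟩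
    · exact Or.inr ⟨-c, by rw [lmap_sr, mul_one]⟩
  · rintro (⟨c, rfl⟩ | ⟨c, rfl⟩)
    · exact ⟨r (-c), by rw [lmap_r, mul_one, neg_neg]⟩
    · exact ⟨sr (-c), by rw [lmap_sr, mul_one, neg_neg]⟩

theorem ZMod.two_ne_zero_of_three_le {m : ℕ} (hm : 3 ≤ m) : (2 : ZMod m) ≠ 0 := by
  intro h
  have hdvd : m ∣ 2 := (ZMod.natCast_eq_zero_iff 2 m).mp (by exact_mod_cast h)
  exact absurd (Nat.le_of_dvd two_pos hdvd) (by omega)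

/-- Lemma 7: `P₁ = C(0,1) ∪̇ C(-2,1)` and `Λ₁ = C(0,1) ∪̇ C(2,1)`, disjoint unions. -/
theorem stmt_5 (m : ℕ) (hm : 3 ≤ m) :
    ({f | ∃ g : DihedralGroup m, f = rmap g} = cont m 0 1 ∪ cont m (-2) 1 ∧
      Disjoint (cont m 0 1) (cont m (-2) 1)) ∧
    ({f | ∃ g : DihedralGroup m, f = lmap g} = cont m 0 1 ∪ cont m 2 1 ∧
      Disjoint (cont m 0 1) (cont m 2 1)) := by
  have h2 := ZMod.two_ne_zero_of_three_le hm
  exact ⟨⟨setOf_rmap m, disjoint_cont (neg_ne_zero.mpr h2).symm 1 1⟩,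
    ⟨setOf_lmap m, disjoint_cont h2.symm 1 1⟩⟩
end

section
/- Let m ≥ 3 and let D_m be the dihedral group of order 2m. For all A, A', B, B' ∈ ℤ_m, the elementwise product of containers satisfies C(A,B) ∘ C(A',B') = C(A·A', B·A'), where C(A,B) ∘ C(A',B') = { μ₁ ∘ μ₂ : μ₁ ∈ C(A,B), μ₂ ∈ C(A',B') } and composition applies μ₁ first. -/
open DihedralGroup

/-- Composing `μ(A,B)` with `μ(A',B')` gives `μ(AA', BA')`. -/
theorem mumap_comp (m : ℕ) (A A' B B' : ZMod m) :
    mumap m A' B' ∘ mumap m A B = mumap m (A * A') (B * A') := by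
  funext g
  cases g <;> simp only [Function.comp_apply, mumap] <;> congr 1 <;> ring

/-- Lemma 8: the elementwise product of containers satisfies
`C(A,B) ∘ C(A',B') = C(AA', BA')`, where the first factor is applied first. -/
theorem stmt_6 (m : ℕ) (hm : 3 ≤ m) (A A' B B' : ZMod m) :
    Set.image2 (fun f g => g ∘ f) (cont m A B) (cont m A' B') = cont m (A * A') (B * A') := by
  ext f
  simp only [Set.mem_image2, cont, Set.mem_ofPred_eq]
  constructor
  · rintro ⟨_, ⟨x, rfl⟩, _, ⟨y, rfl⟩, rfl⟩
    exact ⟨x, by rw [mumap_comp, mul_assoc]⟩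
  · rintro ⟨x, rfl⟩
    exact ⟨_, ⟨x, rfl⟩, _, ⟨0, rfl⟩, by rw [mumap_comp, mul_assoc]⟩
end

section
/- Let G be a metabelian group (i.e., the commutator subgroup of G is abelian), let u ≥ 1, and let g_1, g_2 ∈ G. Then [g_1, x_1, x_2, …, x_u] = [g_2, x_1, x_2, …, x_u] for all x_1, …, x_u ∈ G if and only if g_1⁻¹g_2 ∈ Z_u(G), the u-th term of the upper central series of G. -/
/-- Left-normed iterated commutator: `lnc g [x₁,…,x_u] = [g,x₁,x₂,…,x_u]`. -/
def lnc {G : Type*} [Group G] : G → List G → G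
  | g, [] => g
  | g, x :: xs => lnc (gcomm g x) xs

theorem Subgroup.Normal.inv_mul_mem_iff_mul_inv_mem {G : Type*} [Group G] {N : Subgroup G}
    (hN : N.Normal) (a b : G) : a⁻¹ * b ∈ N ↔ a * b⁻¹ ∈ N := by
  rw [hN.mem_comm_iff, ← inv_mem_iff, mul_inv_rev, inv_inv]

open scoped commutatorElement in
/-- The commutators of `a` and `b` with every element agree modulo `Z_n(G)` exactly when
`a` and `b` agree modulo `Z_{n+1}(G)`. -/
theorem forall_gcomm_inv_mul_mem_upperCentralSeries_iff {G : Type*} [Group G] (n : ℕ) (a b : G) :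
    (∀ x, (gcomm a x)⁻¹ * gcomm b x ∈ Subgroup.upperCentralSeries G n) ↔
      a⁻¹ * b ∈ Subgroup.upperCentralSeries G (n + 1) := by
  have hN : (Subgroup.upperCentralSeries G n).Normal := inferInstance
  have hN' : (Subgroup.upperCentralSeries G (n + 1)).Normal := inferInstance
  rw [hN'.inv_mul_mem_iff_mul_inv_mem, Subgroup.mem_upperCentralSeries_succ_iff]
  refine forall_congr' fun x => ?_
  have h : (gcomm a x)⁻¹ * gcomm b x =
      (a * x)⁻¹ * (⁅a * b⁻¹, x⁆⁻¹ * (a * x)) := by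
    simp only [gcomm, commutatorElement_def]
    group
  rw [h, hN.mem_comm_iff, mul_inv_cancel_right, inv_mem_iff]

/-- In every group, `[a,x₁,…,x_n] = [b,x₁,…,x_n]` for all `x₁,…,x_n` if and only if
`a⁻¹b ∈ Z_n(G)`. -/
theorem forall_lnc_ofFn_eq_iff {G : Type*} [Group G] (n : ℕ) (a b : G) :
    (∀ xs : Fin n → G, lnc a (List.ofFn xs) = lnc b (List.ofFn xs)) ↔
      a⁻¹ * b ∈ Subgroup.upperCentralSeries G n := by
  induction n generalizing a b with
  | zero => simp [lnc, inv_mul_eq_one]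
  | succ n ih =>
    rw [← forall_gcomm_inv_mul_mem_upperCentralSeries_iff]
    simp only [← ih, Fin.forall_fin_succ_pi, List.ofFn_succ, Fin.cons_zero, Fin.cons_succ, lnc]

/-- Theorem 16: in a metabelian group `G`, `[g₁,x₁,…,x_u] = [g₂,x₁,…,x_u]` for all
`x₁,…,x_u ∈ G` if and only if `g₁⁻¹g₂` lies in the `u`-th centre `Z_u(G)`. -/
theorem stmt_12 {G : Type*} [Group G]
    (hG : ∀ x ∈ commutator G, ∀ y ∈ commutator G, x * y = y * x)
    (u : ℕ) (hu : 1 ≤ u) (g₁ g₂ : G) :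
    (∀ xs : Fin u → G, lnc g₁ (List.ofFn xs) = lnc g₂ (List.ofFn xs)) ↔
      g₁⁻¹ * g₂ ∈ upperCentralSeries G u :=
  forall_lnc_ofFn_eq_iff u g₁ g₂
end

section
/- Let m ≥ 3, let D_m be the dihedral group of order 2m, let u ≥ 1, and let g_1, g_2 ∈ D_m. Then [g_1, x_1, x_2, …, x_u] = [g_2, x_1, x_2, …, x_u] for all x_1, …, x_u ∈ D_m if and only if ρ(g_1) ∘ ρ(b)^{u−1} = ρ(g_2) ∘ ρ(b)^{u−1} as maps D_m → D_m (where ρ(b)^{u−1} denotes the (u−1)-fold composition of ρ(b) with itself, and composition applies the left factor first). -/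
open DihedralGroup

theorem gcomm_inv {G : Type*} [Group G] (g h : G) : (gcomm g h)⁻¹ = gcomm h g := by
  simp [gcomm, mul_assoc]

theorem exists_gcomm_eq_r {m : ℕ} (g h : DihedralGroup m) : ∃ d : ZMod m, gcomm g h = r d := by
  cases g <;> cases h <;> simp [gcomm, -r_zero]

theorem gcomm_r_r {m : ℕ} (i j : ZMod m) : gcomm (r i) (r j) = r 0 := by
  simp [gcomm]

theorem gcomm_r_sr {m : ℕ} (i k : ZMod m) : gcomm (r i) (sr k) = r (-2 * i) := by
  simp only [gcomm, inv_r, inv_sr, r_mul_sr, sr_mul_r, sr_mul_sr]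
  congr 1
  ring

theorem rmap_sr_zero_iterate_r {m : ℕ} (n : ℕ) (d : ZMod m) :
    (rmap (sr 0 : DihedralGroup m))^[n] (r d) = r ((-2) ^ n * d) := by
  induction n generalizing d with
  | zero => simp
  | succ n ih =>
    rw [Function.iterate_succ_apply, rmap, gcomm_r_sr, ih, pow_succ, mul_assoc]

theorem lnc_replicate {G : Type*} [Group G] (n : ℕ) (g b : G) :
    lnc g (List.replicate n b) = (rmap b)^[n] g := by
  induction n generalizing g with
  | zero => rfl
  | succ n ih =>
    rw [List.replicate_succ, lnc, ih, Function.iterate_succ_apply, rmap]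

theorem exists_lnc_r_eq {m : ℕ} (l : List (DihedralGroup m)) :
    ∃ e : ZMod m, ∀ d : ZMod m, lnc (r d) l = r (e * ((-2) ^ l.length * d)) := by
  induction l with
  | nil => exact ⟨1, fun d => by simp [lnc]⟩
  | cons x xs ih =>
    obtain ⟨e, he⟩ := ih
    cases x with
    | r j => exact ⟨0, fun d => by rw [lnc, gcomm_r_r, he]; simp⟩
    | sr k => exact ⟨e, fun d => by rw [lnc, gcomm_r_sr, he, List.length_cons, pow_succ, mul_assoc]⟩

theorem rmap_iterate_gcomm_eq_iff {m : ℕ} (n : ℕ) (g₁ g₂ x : DihedralGroup m) :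
    (rmap (sr 0))^[n] (gcomm x g₁) = (rmap (sr 0))^[n] (gcomm x g₂) ↔
      (rmap (sr 0))^[n] (gcomm g₁ x) = (rmap (sr 0))^[n] (gcomm g₂ x) := by
  obtain ⟨d₁, h₁⟩ := exists_gcomm_eq_r g₁ x
  obtain ⟨d₂, h₂⟩ := exists_gcomm_eq_r g₂ x
  rw [← gcomm_inv g₁ x, ← gcomm_inv g₂ x, h₁, h₂]
  simp [rmap_sr_zero_iterate_r]

/-- Lemma 17: in `D_m` (with `b = sr 0`), `[g₁,x₁,…,x_u] = [g₂,x₁,…,x_u]` for all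
`x₁,…,x_u` if and only if `ρ(g₁) ∘ ρ(b)^(u-1) = ρ(g₂) ∘ ρ(b)^(u-1)`
(the left factor applied first). -/
theorem stmt_13 (m : ℕ) (hm : 3 ≤ m) (u : ℕ) (hu : 1 ≤ u) (g₁ g₂ : DihedralGroup m) :
    (∀ xs : Fin u → DihedralGroup m,
        lnc g₁ (List.ofFn xs) = lnc g₂ (List.ofFn xs)) ↔
      (rmap (sr 0 : DihedralGroup m))^[u - 1] ∘ rmap g₁ =
        (rmap (sr 0 : DihedralGroup m))^[u - 1] ∘ rmap g₂ := by
  obtain ⟨n, rfl⟩ := Nat.exists_eq_add_of_le' hu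
  simp only [Nat.add_sub_cancel, funext_iff, Function.comp_apply]
  constructor
  · intro h x
    have hx := h (Fin.cons x fun _ => sr 0)
    simp only [List.ofFn_succ, Fin.cons_zero, Fin.cons_succ, List.ofFn_const, lnc,
      lnc_replicate] at hx
    exact (rmap_iterate_gcomm_eq_iff n g₁ g₂ x).2 hx
  · intro h xs
    have hx := (rmap_iterate_gcomm_eq_iff n g₁ g₂ (xs 0)).1 (h (xs 0))
    obtain ⟨d₁, h₁⟩ := exists_gcomm_eq_r g₁ (xs 0)
    obtain ⟨d₂, h₂⟩ := exists_gcomm_eq_r g₂ (xs 0)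
    obtain ⟨e, he⟩ := exists_lnc_r_eq (List.ofFn fun i : Fin n => xs i.succ)
    rw [h₁, h₂, rmap_sr_zero_iterate_r, rmap_sr_zero_iterate_r, r.injEq] at hx
    rw [List.ofFn_succ, lnc, lnc, h₁, h₂, he, he, List.length_ofFn, hx]
end

section
/- Let m ≥ 3, let D_m be the dihedral group of order 2m, let u ≥ 1, and suppose Z_u(D_m), the u-th term of the upper central series, is contained in the cyclic subgroup ⟨a⟩. Then for x, y ∈ ℤ_m, ρ(a^x b) ∘ ρ(b)^{u−1} = ρ(a^y b) ∘ ρ(b)^{u−1} as maps D_m → D_m if and only if a^{y−x} ∈ Z_u(D_m) (equivalently, a^x Z_u = a^y Z_u in the quotient group ⟨a⟩/Z_u). -/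
open DihedralGroup

namespace DihedralGroup

open scoped commutatorElement

/-- The rotations in the `t`-th term of the upper central series are those killed by `2 ^ t`. -/
theorem r_mem_upperCentralSeries_iff {m : ℕ} (t : ℕ) (i : ZMod m) :
    r i ∈ Subgroup.upperCentralSeries (DihedralGroup m) t ↔ 2 ^ t * i = 0 := by
  induction t generalizing i with
  | zero =>
    rw [Subgroup.upperCentralSeries_zero, Subgroup.mem_bot, one_def, r.injEq, pow_zero, one_mul]
  | succ t ih =>
    have hr (j : ZMod m) : ⁅r i, r j⁆ = 1 := by simp [commutatorElement_def]
    have hsr (j : ZMod m) : ⁅r i, sr j⁆ = r (2 * i) := by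
      simp only [commutatorElement_def, r_mul_sr, inv_r, inv_sr, sr_mul_r, sr_mul_sr, r.injEq]
      ring
    rw [Subgroup.mem_upperCentralSeries_succ_iff, pow_succ, mul_assoc, ← ih]
    refine ⟨fun H => hsr 0 ▸ H (sr 0), fun H g => ?_⟩
    cases g with
    | r j => exact hr j ▸ one_mem _
    | sr j => exact hsr j ▸ H

end DihedralGroup

theorem elt_one (m : ℕ) (x : ZMod m) : elt m x 1 = sr (-x) := by
  simp [elt, ZMod.val_one]

theorem rmap_sr_r {m : ℕ} (c i : ZMod m) : rmap (sr c) (r i) = r (-2 * i) := by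
  simp only [rmap, gcomm, inv_r, inv_sr, r_mul_sr, sr_mul_r, sr_mul_sr, r.injEq]
  ring

theorem rmap_sr_sr {m : ℕ} (c k : ZMod m) : rmap (sr c) (sr k) = r (2 * (c - k)) := by
  simp only [rmap, gcomm, inv_sr, sr_mul_sr, r_mul_sr, r.injEq]
  ring

theorem rmap_sr_iterate_r {m : ℕ} (t : ℕ) (c i : ZMod m) :
    (rmap (sr c))^[t] (r i) = r ((-2) ^ t * i) := by
  induction t with
  | zero => simp
  | succ t ih =>
    rw [Function.iterate_succ_apply', ih, rmap_sr_r]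
    ring_nf

/-- Corollary 18: if `Z_u(D_m) ≤ ⟨a⟩` then
`ρ(a^x b) ∘ ρ(b)^(u-1) = ρ(a^y b) ∘ ρ(b)^(u-1)` iff `a^(y-x) ∈ Z_u(D_m)`. -/
theorem stmt_14 (m : ℕ) (hm : 3 ≤ m) (u : ℕ) (hu : 1 ≤ u)
    (hZ : upperCentralSeries (DihedralGroup m) u ≤ Subgroup.zpowers (r (1 : ZMod m)))
    (x y : ZMod m) :
    (rmap (sr 0 : DihedralGroup m))^[u - 1] ∘ rmap (elt m x 1) =
      (rmap (sr 0 : DihedralGroup m))^[u - 1] ∘ rmap (elt m y 1) ↔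
      r (y - x) ∈ upperCentralSeries (DihedralGroup m) u := by
  obtain ⟨t, rfl⟩ := Nat.exists_eq_add_of_le' hu
  have key (k : ZMod m) : (-2) ^ t * (2 * (-x - k)) = (-2) ^ t * (2 * (-y - k)) ↔
      2 ^ (t + 1) * (y - x) = 0 := by
    rw [← sub_eq_zero, ← ((isUnit_neg_one (α := ZMod m)).pow t).mul_right_eq_zero
      (b := 2 ^ (t + 1) * (y - x)), neg_pow (2 : ZMod m)]
    ring_nf
  refine Iff.trans ?_ (r_mem_upperCentralSeries_iff (t + 1) (y - x)).symm
  rw [elt_one, elt_one, Nat.add_sub_cancel]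
  constructor
  · intro h
    have h0 := congrFun h (sr 0)
    simp only [Function.comp_apply, rmap_sr_sr, rmap_sr_iterate_r, r.injEq] at h0
    exact (key 0).1 h0
  · intro h
    funext g
    cases g with
    | r i => simp only [Function.comp_apply, rmap_sr_r]
    | sr k =>
      simp only [Function.comp_apply, rmap_sr_sr, rmap_sr_iterate_r, r.injEq]
      exact (key k).2 h
end

section
/- Let m ≥ 3, let D_m be the dihedral group of order 2m, let u ≥ 1, and suppose Z_u(D_m) ⊆ ⟨a⟩. For x ∈ ℤ_m, the maps μ((−2)^u, x·(−2)^{u−1}) and μ(2^u, x·2^{u−1}) are defined as in the container notation. Then the cardinality of the container C((−2)^u, (−2)^{u−1}) equals m / |Z_u(D_m)|, and likewise the cardinality of C(2^u, 2^{u−1}) equals m / |Z_u(D_m)|. -/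
open DihedralGroup

theorem r_mem_upperCentralSeries_iff (m u : ℕ) (i : ZMod m) :
    r i ∈ Subgroup.upperCentralSeries (DihedralGroup m) u ↔ 2 ^ u * i = 0 := by
  induction u generalizing i with
  | zero => simp [one_def, -r_zero]
  | succ u ih =>
    rw [Subgroup.mem_upperCentralSeries_succ_iff]
    constructor
    · intro h
      have h0 := h (sr 0)
      simp only [commutatorElement_def, inv_r, inv_sr, r_mul_sr, sr_mul_r, sr_mul_sr, ih] at h0
      linear_combination h0
    · rintro h (j | k)
      · simp [commutatorElement_def]
      · simp only [commutatorElement_def, inv_r, inv_sr, r_mul_sr, sr_mul_r, sr_mul_sr, ih]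
        linear_combination h

theorem card_upperCentralSeries_eq_card_ker (m u : ℕ)
    (hZ : Subgroup.upperCentralSeries (DihedralGroup m) u ≤ Subgroup.zpowers (r (1 : ZMod m))) :
    Nat.card (Subgroup.upperCentralSeries (DihedralGroup m) u) =
      Nat.card (AddMonoidHom.mulLeft ((2 : ZMod m) ^ u)).ker := by
  symm
  refine Nat.card_congr (Equiv.ofBijective
    (fun i => ⟨r i.1, (r_mem_upperCentralSeries_iff m u i.1).2 (AddMonoidHom.mem_ker.1 i.2)⟩) ⟨?_, ?_⟩)
  · rintro ⟨i, hi⟩ ⟨j, hj⟩ h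
    simpa using h
  · rintro ⟨g, hg⟩
    obtain ⟨k, rfl⟩ := Subgroup.mem_zpowers_iff.1 (hZ hg)
    rw [r_one_zpow] at hg
    exact ⟨⟨k, by simpa using (r_mem_upperCentralSeries_iff m u k).1 hg⟩,
      Subtype.ext (r_one_zpow k).symm⟩

theorem card_cont_eq_card_range (m : ℕ) (A B : ZMod m) :
    Nat.card (cont m A B) = Nat.card (AddMonoidHom.mulLeft (2 * B)).range := by
  refine Nat.card_congr (Equiv.ofBijective (fun f => ⟨2 * B * f.2.choose, f.2.choose, rfl⟩) ⟨?_, ?_⟩)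
  · rintro ⟨f, hf⟩ ⟨g, hg⟩ h
    have h' : 2 * B * hf.choose = 2 * B * hg.choose := congrArg Subtype.val h
    apply Subtype.ext
    change f = g
    rw [hf.choose_spec, hg.choose_spec]
    funext y
    rcases y with i | k
    · rfl
    · exact congrArg r (by linear_combination h')
  · rintro ⟨_, x, rfl⟩
    have hf : mumap m A (x * B) ∈ cont m A B := ⟨x, rfl⟩
    refine ⟨⟨_, hf⟩, Subtype.ext ?_⟩
    have h := r.inj (congrFun hf.choose_spec (sr 0))
    change 2 * B * hf.choose = 2 * B * x
    linear_combination -h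

theorem card_cont_eq_div (m u : ℕ) (hm : m ≠ 0) (A B : ZMod m)
    (hZ : Subgroup.upperCentralSeries (DihedralGroup m) u ≤ Subgroup.zpowers (r (1 : ZMod m)))
    (hB : ∀ i, 2 * B * i = 0 ↔ 2 ^ u * i = 0) :
    Nat.card (cont m A B) = m / Nat.card (Subgroup.upperCentralSeries (DihedralGroup m) u) := by
  have : NeZero m := ⟨hm⟩
  have hker : (AddMonoidHom.mulLeft (2 * B)).ker = (AddMonoidHom.mulLeft ((2 : ZMod m) ^ u)).ker :=
    AddSubgroup.ext fun i => by simpa using hB i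
  rw [card_cont_eq_card_range, card_upperCentralSeries_eq_card_ker m u hZ, ← hker]
  have h := AddSubgroup.card_mul_index (AddMonoidHom.mulLeft (2 * B)).ker
  rw [AddSubgroup.index_ker, Nat.card_zmod] at h
  exact (Nat.div_eq_of_eq_mul_right Nat.card_pos h.symm).symm

/-- Theorem 19: if `Z_u(D_m) ≤ ⟨a⟩`, then
`|C((-2)^u, (-2)^(u-1))| = m / |Z_u(D_m)| = |C(2^u, 2^(u-1))|`. -/
theorem stmt_15 (m : ℕ) (hm : 3 ≤ m) (u : ℕ) (hu : 1 ≤ u)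
    (hZ : upperCentralSeries (DihedralGroup m) u ≤ Subgroup.zpowers (r (1 : ZMod m))) :
    Nat.card ↥(cont m ((-2) ^ u) ((-2) ^ (u - 1))) =
      m / Nat.card ↥(upperCentralSeries (DihedralGroup m) u) ∧
    Nat.card ↥(cont m ((2 : ZMod m) ^ u) ((2 : ZMod m) ^ (u - 1))) =
      m / Nat.card ↥(upperCentralSeries (DihedralGroup m) u) := by
  obtain ⟨n, rfl⟩ := Nat.exists_eq_add_of_le' hu
  refine ⟨card_cont_eq_div m _ (by omega) _ _ hZ fun i => ?_,
    card_cont_eq_div m _ (by omega) _ _ hZ fun i => ?_⟩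
  · rw [Nat.add_sub_cancel, neg_pow, pow_succ']
    rcases neg_one_pow_eq_or (ZMod m) n with h | h <;> simp [h]
  · rw [Nat.add_sub_cancel, pow_succ']
end

section
/- Let m ≥ 3 and let D_m be the dihedral group of order 2m. Then the cardinality of the container C(0,1) equals m / |Z_1(D_m)|, where Z_1(D_m) is the centre of D_m. -/
open DihedralGroup

theorem DihedralGroup.r_mem_center_iff {m : ℕ} (i : ZMod m) :
    r i ∈ Subgroup.center (DihedralGroup m) ↔ 2 * i = 0 := by
  rw [Subgroup.mem_center_iff]
  constructor
  · intro h
    have h0 := h (sr 0)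
    simp only [sr_mul_r, r_mul_sr, sr.injEq] at h0
    linear_combination h0
  · rintro h (j | j)
    · simp [add_comm]
    · simp only [sr_mul_r, r_mul_sr, sr.injEq]
      linear_combination h

theorem DihedralGroup.sr_notMem_center {m : ℕ} (hm : 3 ≤ m) (i : ZMod m) :
    sr i ∉ Subgroup.center (DihedralGroup m) := by
  rw [Subgroup.mem_center_iff]
  intro h
  have h1 := h (r 1)
  simp only [sr_mul_r, r_mul_sr, sr.injEq] at h1
  have h2 : ((2 : ℕ) : ZMod m) = 0 := by
    push_cast
    linear_combination -h1
  rw [ZMod.natCast_eq_zero_iff] at h2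
  have := Nat.le_of_dvd two_pos h2
  omega

theorem DihedralGroup.nat_card_center {m : ℕ} (hm : 3 ≤ m) :
    Nat.card (Subgroup.center (DihedralGroup m)) =
      Nat.card (AddMonoidHom.mulLeft (2 : ZMod m)).ker := by
  symm
  refine Nat.card_congr (Equiv.ofBijective
    (fun x => ⟨r x.1, (r_mem_center_iff x.1).2 x.2⟩) ⟨fun x y h => ?_, ?_⟩)
  · exact Subtype.ext (r.inj (congrArg Subtype.val h))
  · rintro ⟨i | i, hi⟩
    · exact ⟨⟨i, (r_mem_center_iff i).1 hi⟩, rfl⟩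
    · exact absurd hi (sr_notMem_center hm i)

theorem mumap_zero_eq_iff {m : ℕ} (x y : ZMod m) :
    mumap m 0 x = mumap m 0 y ↔ 2 * x = 2 * y := by
  constructor
  · intro h
    simpa [mumap] using congrFun h (sr 0)
  · intro h
    funext g
    cases g <;> simp [mumap, h]

theorem nat_card_cont_zero_one (m : ℕ) :
    Nat.card (cont m 0 1) = Nat.card (AddMonoidHom.mulLeft (2 : ZMod m)).range := by
  refine Nat.card_congr (Equiv.ofBijective
    (fun f => ⟨2 * f.2.choose, f.2.choose, rfl⟩) ⟨fun f g h => ?_, ?_⟩)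
  · have h' : 2 * f.2.choose = 2 * g.2.choose := congrArg Subtype.val h
    apply Subtype.ext
    rw [f.2.choose_spec, g.2.choose_spec, mul_one, mul_one]
    exact (mumap_zero_eq_iff _ _).2 h'
  · rintro ⟨_, x, rfl⟩
    have hx : mumap m 0 x ∈ cont m 0 1 := ⟨x, by rw [mul_one]⟩
    refine ⟨⟨_, hx⟩, Subtype.ext ?_⟩
    have hs := hx.choose_spec
    rw [mul_one] at hs
    exact ((mumap_zero_eq_iff _ _).1 hs).symm

/-- Lemma 20: `|C(0,1)| = m / |Z_1(D_m)|`, where `Z_1(D_m)` is the centre. -/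
theorem stmt_16 (m : ℕ) (hm : 3 ≤ m) :
    Nat.card ↥(cont m 0 1) = m / Nat.card ↥(Subgroup.center (DihedralGroup m)) := by
  have hpos : 0 < Nat.card (Subgroup.center (DihedralGroup m)) := by
    have : NeZero m := ⟨by omega⟩
    exact Nat.card_pos
  refine (Nat.div_eq_of_eq_mul_left hpos ?_).symm
  rw [nat_card_cont_zero_one, DihedralGroup.nat_card_center hm]
  have h := (AddMonoidHom.mulLeft (2 : ZMod m)).ker.card_mul_index
  rw [AddSubgroup.index_ker, Nat.card_zmod] at h
  rw [mul_comm, h]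
end

section
/- Let p be an odd prime. Then |P(D_p)| = |P(D_{2p})| and |Λ(D_p)| = |Λ(D_{2p})|, where |·| denotes the cardinality of the commutation semigroup as a set of maps. -/
open DihedralGroup

/-- The right commutation semigroup `P(D_m)`. -/
def Psg (m : ℕ) : Subsemigroup (Function.End (DihedralGroup m)) :=
  Subsemigroup.closure {f : Function.End (DihedralGroup m) | ∃ g : DihedralGroup m, f = rmap g}

/-- The left commutation semigroup `Λ(D_m)`. -/
def Lsg (m : ℕ) : Subsemigroup (Function.End (DihedralGroup m)) :=
  Subsemigroup.closure {f : Function.End (DihedralGroup m) | ∃ g : DihedralGroup m, f = lmap g}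

/-- If `π : H → G` has a section `s`, then `f ↦ s ∘ f ∘ π` is an embedding of semigroups. -/
def conjEnd {G H : Type*} (π : H → G) (s : G → H) (hs : ∀ g, π (s g) = g) :
    Function.End G →ₙ* Function.End H where
  toFun f := fun x => s (f (π x))
  map_mul' f g := by
    funext x
    change s (f (g (π x))) = s (f (π (s (g (π x)))))
    rw [hs]

theorem conjEnd_injective {G H : Type*} (π : H → G) (s : G → H) (hs : ∀ g, π (s g) = g) :
    Function.Injective (conjEnd π s hs) := by
  intro f g h
  funext x
  have h1 : s (f (π (s x))) = s (g (π (s x))) := congrFun h (s x)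
  rw [hs] at h1
  rw [← hs (f x), h1, hs]

/-- Semigroups generated by families of maps intertwined by `conjEnd` have equal cardinality. -/
theorem card_closure_eq_of_section {G H : Type*} (π : H → G) (s : G → H)
    (hs : ∀ g, π (s g) = g) (c : G → Function.End G) (d : H → Function.End H)
    (hcd : ∀ h x, d h x = s (c (π h) (π x))) :
    Nat.card (Subsemigroup.closure {f : Function.End G | ∃ g, f = c g}) =
      Nat.card (Subsemigroup.closure {f : Function.End H | ∃ h, f = d h}) := by
  have himage : conjEnd π s hs '' {f : Function.End G | ∃ g, f = c g} =
      {f : Function.End H | ∃ h, f = d h} := by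
    ext f
    constructor
    · rintro ⟨_, ⟨g, rfl⟩, rfl⟩
      refine ⟨s g, funext fun x => ?_⟩
      rw [hcd, hs]
      rfl
    · rintro ⟨h, rfl⟩
      exact ⟨c (π h), ⟨π h, rfl⟩, funext fun x => (hcd h x).symm⟩
  rw [← himage, ← MulHom.map_mclosure]
  exact Nat.card_congr
    (Subsemigroup.equivMapOfInjective _ _ (conjEnd_injective π s hs)).toEquiv

/-- Reduction `D_{2m} → D_m`. -/
def dihedralReduce (m : ℕ) : DihedralGroup (2 * m) → DihedralGroup m
  | .r i => .r (ZMod.castHom (dvd_mul_left m 2) (ZMod m) i)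
  | .sr i => .sr (ZMod.castHom (dvd_mul_left m 2) (ZMod m) i)

/-- For odd `m`, the section of `ℤ_{2m} → ℤ_m` whose values are even. -/
def evenLift (m : ℕ) (i : ZMod m) : ZMod (2 * m) := (((m + 1) * i.val : ℕ) : ZMod (2 * m))

/-- For odd `m`, the section of `D_{2m} → D_m` with even exponents. -/
def dihedralLift (m : ℕ) : DihedralGroup m → DihedralGroup (2 * m)
  | .r i => .r (evenLift m i)
  | .sr i => .sr (evenLift m i)

theorem castHom_evenLift (m : ℕ) [NeZero m] (i : ZMod m) :
    ZMod.castHom (dvd_mul_left m 2) (ZMod m) (evenLift m i) = i := by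
  rw [evenLift, map_natCast]
  simp

theorem evenLift_castHom_two_mul {m : ℕ} [NeZero m] (hm : Odd m) (j : ZMod (2 * m)) :
    evenLift m (ZMod.castHom (dvd_mul_left m 2) (ZMod m) (2 * j)) = 2 * j := by
  obtain ⟨n, rfl⟩ := ZMod.natCast_zmod_surjective j
  have h : ZMod.castHom (dvd_mul_left m 2) (ZMod m) (2 * (n : ZMod (2 * m))) =
      ((2 * n : ℕ) : ZMod m) := by
    rw [map_mul, map_ofNat, map_natCast]; push_cast; rfl
  have h2 : (2 * (n : ZMod (2 * m))) = ((2 * n : ℕ) : ZMod (2 * m)) := by push_cast; rfl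
  rw [h, evenLift, ZMod.val_natCast, h2, ZMod.natCast_eq_natCast_iff]
  have hcop : Nat.Coprime 2 m := Nat.coprime_two_left.mpr hm
  refine (Nat.modEq_and_modEq_iff_modEq_mul hcop).mp ⟨?_, ?_⟩
  · have h1 : (m + 1) ≡ 0 [MOD 2] := by
      obtain ⟨k, rfl⟩ := hm
      simp only [Nat.ModEq]; omega
    have h3 : 2 * n ≡ 0 * (2 * n % m) [MOD 2] := by simp [Nat.ModEq]
    exact (h1.mul_right _).trans h3.symm
  · have h1 : (m + 1) ≡ 1 [MOD m] := by simp [Nat.ModEq]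
    simpa using h1.mul (Nat.mod_modEq (2 * n) m)

theorem dihedralReduce_lift (m : ℕ) [NeZero m] (g : DihedralGroup m) :
    dihedralReduce m (dihedralLift m g) = g := by
  cases g with
  | r i => exact congrArg r (castHom_evenLift m i)
  | sr i => exact congrArg sr (castHom_evenLift m i)

/-- Commutators in `D_{2m}`, `m` odd, are the lifts of commutators in `D_m`. -/
theorem gcomm_eq_lift {m : ℕ} [NeZero m] (hm : Odd m) (x y : DihedralGroup (2 * m)) :
    gcomm x y = dihedralLift m (gcomm (dihedralReduce m x) (dihedralReduce m y)) := by
  have key (a : ZMod (2 * m)) (b : ZMod m) (j : ZMod (2 * m)) (ha : a = 2 * j)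
      (hb : b = ZMod.castHom (dvd_mul_left m 2) (ZMod m) (2 * j)) : a = evenLift m b := by
    rw [hb, evenLift_castHom_two_mul hm, ha]
  rcases x with i | i <;> rcases y with k | k <;>
    simp only [gcomm, dihedralReduce, dihedralLift, inv_r, inv_sr, r_mul_r, r_mul_sr, sr_mul_r,
      sr_mul_sr] <;> congr 1
  · exact key _ _ 0 (by ring) (by simp only [map_mul, map_zero]; ring)
  · exact key _ _ (-i) (by ring) (by simp only [map_mul, map_neg, map_ofNat]; ring)
  · exact key _ _ k (by ring) (by simp only [map_mul, map_ofNat]; ring)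
  · exact key _ _ (k - i) (by ring) (by simp only [map_mul, map_sub, map_ofNat]; ring)

/-- Theorem 22: for an odd prime `p`, `|P(D_p)| = |P(D_{2p})|` and `|Λ(D_p)| = |Λ(D_{2p})|`. -/
theorem stmt_18 (p : ℕ) (hp : p.Prime) (hodd : Odd p) :
    Nat.card ↥(Psg p) = Nat.card ↥(Psg (2 * p)) ∧
    Nat.card ↥(Lsg p) = Nat.card ↥(Lsg (2 * p)) := by
  have : NeZero p := ⟨hp.ne_zero⟩
  exact ⟨card_closure_eq_of_section _ _ (dihedralReduce_lift p) rmap rmap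
      fun h x => gcomm_eq_lift hodd x h,
    card_closure_eq_of_section _ _ (dihedralReduce_lift p) lmap lmap
      fun h x => gcomm_eq_lift hodd h x⟩
end
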